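/- Let n ≥ 1, m ≥ 1, p > 1, and let u = (u_1,…,u_m) be a smooth stable solution of Δ²u_i = |u|^{p−1} u_i on ℝⁿ; set w_i = Δu_i and |w| = (Σ_i w_i²)^{1/2}. Then there is a constant C > 0, independent of R > 0 and x ∈ ℝⁿ, such that ∫_{B_R(x)} ( |w|² + |u|^{p+1} ) ≤ C R^{−4} ∫_{B_{2R}(x) ∖ B_R(x)} |u|² + C R^{−2} ∫_{B_{2R}(x) ∖ B_R(x)} |u| |w|, and consequently ∫_{B_R(x)} ( |w|² + |u|^{p+1} ) ≤ C R^{n − 4(p+1)/(p−1)} for all R ≥ 1. -/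

import Mathlib

open MeasureTheory Metric Filter Real Set

noncomputable section

/-- `n`-dimensional Euclidean space. -/
abbrev Euc (n : ℕ) := EuclideanSpace ℝ (Fin n)

/-- Laplacian of a scalar function on Euclidean space. -/
def lap {n : ℕ} (f : Euc n → ℝ) (x : Euc n) : ℝ :=
  ∑ i : Fin n, iteratedFDeriv ℝ 2 f x ![EuclideanSpace.single i 1, EuclideanSpace.single i 1]

/-- Stability (quadratic form) inequality for the fourth order Lane–Emden system, tested
against families of smooth compactly supported functions whose supports lie in `S`:
`Σ_i ∫ |u|^{p−1} φ_i² + (p−1) Σ_{i,j} ∫ |u|^{p−3} u_i u_j φ_i φ_j ≤ Σ_i ∫ |Δφ_i|²`.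
(Since `‖u x‖ ^ (p−3)` is interpreted with `Real.rpow`, the term `|u|^{p−3} u_i u_j`
vanishes on the set where `u = 0`, for any `p > 1`.) -/
def Stable2 (n m : ℕ) (p : ℝ) (u : Euc n → EuclideanSpace ℝ (Fin m))
    (S : Set (Euc n)) : Prop :=
  ∀ φ : Fin m → Euc n → ℝ,
    (∀ i, ContDiff ℝ (⊤ : ℕ∞) (φ i)) → (∀ i, HasCompactSupport (φ i)) →
    (∀ i, tsupport (φ i) ⊆ S) →
    (∑ i, ∫ x, ‖u x‖ ^ (p - 1) * (φ i x) ^ 2) +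
      (p - 1) * ∑ i, ∑ j, ∫ x, ‖u x‖ ^ (p - 3) * u x i * u x j * φ i x * φ j x
      ≤ ∑ i, ∫ x, (lap (φ i) x) ^ 2

/-- The `i`-th partial derivative of a scalar function on Euclidean space. -/
def pderivE {n : ℕ} (i : Fin n) (f : Euc n → ℝ) (x : Euc n) : ℝ :=
  fderiv ℝ f x (EuclideanSpace.single i 1)

lemma ContDiff.pderivE {n : ℕ} {f : Euc n → ℝ} (hf : ContDiff ℝ (⊤ : ℕ∞) f) (i : Fin n) :
    ContDiff ℝ (⊤ : ℕ∞) (pderivE i f) :=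
  (hf.fderiv_right (m := (⊤ : ℕ∞)) (by simp)).clm_apply contDiff_const

lemma pderivE_mul {n : ℕ} {f g : Euc n → ℝ} (hf : ContDiff ℝ (⊤ : ℕ∞) f)
    (hg : ContDiff ℝ (⊤ : ℕ∞) g) (i : Fin n) :
    pderivE i (fun x => f x * g x) = fun x => f x * pderivE i g x + g x * pderivE i f x := by
  funext x
  simp only [pderivE]
  rw [fderiv_fun_mul (hf.differentiable (by simp) x) (hg.differentiable (by simp) x)]
  simp

lemma pderivE_add {n : ℕ} {f g : Euc n → ℝ} (hf : ContDiff ℝ (⊤ : ℕ∞) f)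
    (hg : ContDiff ℝ (⊤ : ℕ∞) g) (i : Fin n) :
    pderivE i (fun x => f x + g x) = fun x => pderivE i f x + pderivE i g x := by
  funext x
  simp only [pderivE]
  rw [fderiv_fun_add (hf.differentiable (by simp) x) (hg.differentiable (by simp) x)]
  simp

lemma lap_eq_sum_pderivE {n : ℕ} {f : Euc n → ℝ} (hf : ContDiff ℝ (⊤ : ℕ∞) f) :
    lap f = fun x => ∑ i, pderivE i (pderivE i f) x := by
  funext x
  refine Finset.sum_congr rfl fun i _ => ?_
  rw [iteratedFDeriv_two_apply]
  change _ = fderiv ℝ (fun y => fderiv ℝ f y (EuclideanSpace.single i 1)) x _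
  rw [fderiv_clm_apply ((hf.fderiv_right (m := (⊤ : ℕ∞)) (by simp)).differentiable (by simp) x)
    (differentiableAt_const _)]
  simp

lemma ContDiff.lap {n : ℕ} {f : Euc n → ℝ} (hf : ContDiff ℝ (⊤ : ℕ∞) f) :
    ContDiff ℝ (⊤ : ℕ∞) (lap f) := by
  rw [lap_eq_sum_pderivE hf]
  exact ContDiff.sum fun i _ => (hf.pderivE i).pderivE i

lemma lap_mul {n : ℕ} {f g : Euc n → ℝ} (hf : ContDiff ℝ (⊤ : ℕ∞) f)
    (hg : ContDiff ℝ (⊤ : ℕ∞) g) (x : Euc n) :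
    lap (fun x => f x * g x) x =
      f x * lap g x + 2 * ∑ i, pderivE i f x * pderivE i g x + g x * lap f x := by
  rw [lap_eq_sum_pderivE (hf.mul hg), lap_eq_sum_pderivE hf, lap_eq_sum_pderivE hg]
  simp only [Finset.mul_sum, ← Finset.sum_add_distrib]
  refine Finset.sum_congr rfl fun i _ => ?_
  rw [pderivE_mul hf hg, pderivE_add (hf.mul (hg.pderivE i)) (hg.mul (hf.pderivE i)),
    pderivE_mul hf (hg.pderivE i), pderivE_mul hg (hf.pderivE i)]
  ring

lemma HasCompactSupport.fun_sq {n : ℕ} {f : Euc n → ℝ} (hf : HasCompactSupport f) :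
    HasCompactSupport (fun x => f x ^ 2) := by
  simp only [sq]
  exact hf.mul_left

lemma HasCompactSupport.pderivE {n : ℕ} {f : Euc n → ℝ} (hf : HasCompactSupport f)
    (i : Fin n) : HasCompactSupport (pderivE i f) :=
  (hf.fderiv (𝕜 := ℝ)).comp_left (g := fun L : Euc n →L[ℝ] ℝ => L (EuclideanSpace.single i 1))
    (by simp)

lemma HasCompactSupport.lap {n : ℕ} {f : Euc n → ℝ} (hf : HasCompactSupport f) :
    HasCompactSupport (lap f) :=
  (hf.iteratedFDeriv (𝕜 := ℝ) 2).comp_left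
    (g := fun L : ContinuousMultilinearMap ℝ (fun _ : Fin 2 => Euc n) ℝ =>
      ∑ i : Fin n, L ![EuclideanSpace.single i 1, EuclideanSpace.single i 1]) (by simp)

lemma integral_mul_pderivE {n : ℕ} {f g : Euc n → ℝ} (hf : ContDiff ℝ (⊤ : ℕ∞) f)
    (hg : ContDiff ℝ (⊤ : ℕ∞) g) (hc : HasCompactSupport g) (i : Fin n) :
    ∫ x, f x * pderivE i g x = -∫ x, pderivE i f x * g x := by
  refine integral_mul_fderiv_eq_neg_fderiv_mul_of_integrable ?_ ?_ ?_
    (fun x _ => hf.differentiable (by simp) x) (fun x _ => hg.differentiable (by simp) x)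
  · exact ((hf.pderivE i).continuous.mul hg.continuous).integrable_of_hasCompactSupport
      hc.mul_left
  · exact (hf.continuous.mul (hg.pderivE i).continuous).integrable_of_hasCompactSupport
      (hc.pderivE i).mul_left
  · exact (hf.continuous.mul hg.continuous).integrable_of_hasCompactSupport hc.mul_left

/-- Green's second identity for a smooth and a test function. -/
lemma integral_mul_lap {n : ℕ} {f g : Euc n → ℝ} (hf : ContDiff ℝ (⊤ : ℕ∞) f)
    (hg : ContDiff ℝ (⊤ : ℕ∞) g) (hc : HasCompactSupport g) :
    ∫ x, f x * lap g x = ∫ x, lap f x * g x := by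
  rw [lap_eq_sum_pderivE hf, lap_eq_sum_pderivE hg]
  simp only [Finset.mul_sum, Finset.sum_mul]
  rw [integral_finsetSum, integral_finsetSum]
  · refine Finset.sum_congr rfl fun i _ => ?_
    rw [integral_mul_pderivE hf (hg.pderivE i) (hc.pderivE i),
      integral_mul_pderivE (hf.pderivE i) hg hc, neg_neg]
  · exact fun i _ => (((hf.pderivE i).pderivE i).continuous.mul
      hg.continuous).integrable_of_hasCompactSupport hc.mul_left
  · exact fun i _ => (hf.continuous.mul
      ((hg.pderivE i).pderivE i).continuous).integrable_of_hasCompactSupport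
      ((hc.pderivE i).pderivE i).mul_left

/-- The squared length of the gradient. -/
def gradSq {n : ℕ} (f : Euc n → ℝ) (x : Euc n) : ℝ := ∑ i, pderivE i f x * pderivE i f x

lemma ContDiff.gradSq {n : ℕ} {f : Euc n → ℝ} (hf : ContDiff ℝ (⊤ : ℕ∞) f) :
    ContDiff ℝ (⊤ : ℕ∞) (gradSq f) :=
  ContDiff.sum fun i _ => (hf.pderivE i).mul (hf.pderivE i)

lemma gradSq_nonneg {n : ℕ} (f : Euc n → ℝ) (x : Euc n) : 0 ≤ gradSq f x :=
  Finset.sum_nonneg fun _ _ => mul_self_nonneg _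

lemma hasCompactSupport_gradSq {n : ℕ} {f : Euc n → ℝ} (hf : HasCompactSupport f) :
    HasCompactSupport (gradSq f) := by
  refine (hf.fderiv (𝕜 := ℝ)).comp_left (g := fun L : Euc n →L[ℝ] ℝ =>
    ∑ i, L (EuclideanSpace.single i 1) * L (EuclideanSpace.single i 1)) (by simp)

/-- The error density produced by localising the fourth-order energy of `f` with `ψ`. -/
def cutoffError {n : ℕ} (f ψ : Euc n → ℝ) (x : Euc n) : ℝ :=
  f x ^ 2 * (|lap (gradSq ψ) x| + lap ψ x ^ 2) + |f x * lap f x| * gradSq ψ x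

lemma integrable_cutoffError {n : ℕ} {f ψ : Euc n → ℝ} (hf : ContDiff ℝ (⊤ : ℕ∞) f)
    (hψ : ContDiff ℝ (⊤ : ℕ∞) ψ) (hc : HasCompactSupport ψ) :
    Integrable (cutoffError f ψ) := by
  have hL := hψ.lap.continuous
  have hG := hψ.gradSq.continuous
  have hLG := hψ.gradSq.lap.continuous
  have hLf := hf.lap.continuous
  have hf' := hf.continuous
  have hcG := hasCompactSupport_gradSq hc
  refine Continuous.integrable_of_hasCompactSupport (by unfold cutoffError; fun_prop) ?_
  refine HasCompactSupport.add (HasCompactSupport.mul_left (HasCompactSupport.add ?_ ?_))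
    hcG.mul_left
  · exact hcG.lap.comp_left (g := fun t : ℝ => |t|) (by simp)
  · exact hc.lap.fun_sq

/-- The weighted Dirichlet energy is controlled by the error density. -/
lemma integral_gradSq_mul_gradSq_le {n : ℕ} {f ψ : Euc n → ℝ} (hf : ContDiff ℝ (⊤ : ℕ∞) f)
    (hψ : ContDiff ℝ (⊤ : ℕ∞) ψ) (hc : HasCompactSupport ψ) :
    ∫ x, gradSq f x * gradSq ψ x ≤ ∫ x, cutoffError f ψ x := by
  have hcG := hasCompactSupport_gradSq hc
  have hgreen := integral_mul_lap (hf.mul hf) hψ.gradSq hcG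
  have hexp : ∀ x, lap (fun x => f x * f x) x = 2 * (f x * lap f x) + 2 * gradSq f x := by
    intro x
    rw [lap_mul hf hf, gradSq]
    ring
  simp only [hexp] at hgreen
  have hcf := hf.continuous
  have hLf := hf.lap.continuous
  have hGf := hf.gradSq.continuous
  have hG := hψ.gradSq.continuous
  have hLG := hψ.gradSq.lap.continuous
  have i1 : Integrable (fun x => gradSq f x * gradSq ψ x) :=
    (hGf.mul hG).integrable_of_hasCompactSupport hcG.mul_left
  have i2 : Integrable (fun x => f x * lap f x * gradSq ψ x) :=
    Continuous.integrable_of_hasCompactSupport (by fun_prop) hcG.mul_left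
  have i3 : Integrable (fun x => f x * f x * lap (gradSq ψ) x) :=
    Continuous.integrable_of_hasCompactSupport (by fun_prop) hcG.lap.mul_left
  have h1 : ∫ x, (2 * (f x * lap f x) + 2 * gradSq f x) * gradSq ψ x
      = 2 * (∫ x, f x * lap f x * gradSq ψ x) + 2 * ∫ x, gradSq f x * gradSq ψ x := by
    rw [← integral_const_mul, ← integral_const_mul,
      ← integral_add (i2.const_mul 2) (i1.const_mul 2)]
    congr 1
    funext x
    ring
  have h2 : ∫ x, gradSq f x * gradSq ψ x
      = ∫ x, (1 / 2 * (f x * f x * lap (gradSq ψ) x) - f x * lap f x * gradSq ψ x) := by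
    rw [integral_sub (i3.const_mul _) i2, integral_const_mul]
    linarith
  rw [h2]
  refine integral_mono ((i3.const_mul _).sub i2) (integrable_cutoffError hf hψ hc) fun x => ?_
  simp only [cutoffError]
  have e1 := mul_le_mul_of_nonneg_left (le_abs_self (lap (gradSq ψ) x)) (mul_self_nonneg (f x))
  have e2 := mul_le_mul_of_nonneg_right (neg_abs_le (f x * lap f x)) (gradSq_nonneg ψ x)
  have e3 := mul_nonneg (mul_self_nonneg (f x)) (abs_nonneg (lap (gradSq ψ) x))
  have e4 := mul_nonneg (mul_self_nonneg (f x)) (sq_nonneg (lap ψ x))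
  nlinarith

lemma sq_sum_pderivE_mul_le {n : ℕ} (f g : Euc n → ℝ) (x : Euc n) :
    (∑ i, pderivE i f x * pderivE i g x) ^ 2 ≤ gradSq f x * gradSq g x := by
  simpa only [gradSq, sq] using Finset.sum_mul_sq_le_sq_mul_sq Finset.univ
    (fun i => pderivE i f x) (fun i => pderivE i g x)

/-- The energy of `f ψ` compared with the bilaplacian of `f` tested against `f ψ²`. -/
lemma integral_lap_mul_sq_le {n : ℕ} {f ψ : Euc n → ℝ} (hf : ContDiff ℝ (⊤ : ℕ∞) f)
    (hψ : ContDiff ℝ (⊤ : ℕ∞) ψ) (hc : HasCompactSupport ψ) :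
    ∫ x, lap (fun y => f y * ψ y) x ^ 2
      ≤ (∫ x, lap (lap f) x * (f x * ψ x ^ 2)) + 10 * ∫ x, cutoffError f ψ x := by
  have hfψ := hf.mul hψ
  have hc' : HasCompactSupport (fun y => f y * ψ y) := hc.mul_left
  have hsm : ContDiff ℝ (⊤ : ℕ∞) (fun y => f y * ψ y * ψ y) := hfψ.mul hψ
  have hcs : HasCompactSupport (fun y => f y * ψ y * ψ y) := hc.mul_left
  have hgreen := integral_mul_lap hf.lap hsm hcs
  have hcG := hasCompactSupport_gradSq hc
  have i0 := integrable_cutoffError hf hψ hc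
  have i1 : Integrable (fun x => gradSq f x * gradSq ψ x) :=
    (hf.gradSq.continuous.mul hψ.gradSq.continuous).integrable_of_hasCompactSupport hcG.mul_left
  have i2 : Integrable (fun x => lap f x * lap (fun y => f y * ψ y * ψ y) x) :=
    (hf.lap.continuous.mul hsm.lap.continuous).integrable_of_hasCompactSupport hcs.lap.mul_left
  have i3 : Integrable (fun x => lap (fun y => f y * ψ y) x ^ 2) :=
    (hfψ.lap.continuous.pow 2).integrable_of_hasCompactSupport hc'.lap.fun_sq
  have i4 : Integrable (fun x => 8 * (gradSq f x * gradSq ψ x) + 2 * cutoffError f ψ x) :=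
    (i1.const_mul 8).add (i0.const_mul 2)
  have key : ∫ x, lap (fun y => f y * ψ y) x ^ 2 ≤
      ∫ x, (lap f x * lap (fun y => f y * ψ y * ψ y) x
        + (8 * (gradSq f x * gradSq ψ x) + 2 * cutoffError f ψ x)) := by
    refine integral_mono i3 (i2.add i4) fun x => ?_
    have hcross : ∑ i, pderivE i (fun y => f y * ψ y) x * pderivE i ψ x
        = f x * gradSq ψ x + ψ x * ∑ i, pderivE i f x * pderivE i ψ x := by
      simp only [gradSq, Finset.mul_sum, ← Finset.sum_add_distrib]
      refine Finset.sum_congr rfl fun i _ => ?_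
      rw [pderivE_mul hf hψ]
      ring
    have hCS := sq_sum_pderivE_mul_le f ψ x
    simp only [cutoffError]
    rw [lap_mul hfψ hψ, hcross, lap_mul hf hψ]
    set Γ := ∑ i, pderivE i f x * pderivE i ψ x
    have e1 := mul_le_mul_of_nonneg_right (neg_abs_le (f x * lap f x)) (gradSq_nonneg ψ x)
    have e3 := mul_nonneg (sq_nonneg (f x)) (abs_nonneg (lap (gradSq ψ) x))
    have e4 := sq_nonneg (2 * Γ - f x * lap ψ x)
    linarith
  rw [integral_add i2 i4,
    integral_add (i1.const_mul 8) (i0.const_mul 2), integral_const_mul, integral_const_mul,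
    hgreen] at key
  have h4 := integral_gradSq_mul_gradSq_le hf hψ hc
  have h5 : ∫ x, lap (lap f) x * (f x * ψ x * ψ x) = ∫ x, lap (lap f) x * (f x * ψ x ^ 2) := by
    congr 1
    funext x
    ring
  rw [h5] at key
  linarith

lemma integral_lap_sq_mul_sq_le {n : ℕ} {f ψ : Euc n → ℝ} (hf : ContDiff ℝ (⊤ : ℕ∞) f)
    (hψ : ContDiff ℝ (⊤ : ℕ∞) ψ) (hc : HasCompactSupport ψ) :
    ∫ x, lap f x ^ 2 * ψ x ^ 2
      ≤ 3 * (∫ x, lap (fun y => f y * ψ y) x ^ 2) + 15 * ∫ x, cutoffError f ψ x := by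
  have hfψ := hf.mul hψ
  have hc' : HasCompactSupport (fun y => f y * ψ y) := hc.mul_left
  have hcG := hasCompactSupport_gradSq hc
  have i0 := integrable_cutoffError hf hψ hc
  have i1 : Integrable (fun x => gradSq f x * gradSq ψ x) :=
    (hf.gradSq.continuous.mul hψ.gradSq.continuous).integrable_of_hasCompactSupport hcG.mul_left
  have i2 : Integrable (fun x => lap f x ^ 2 * ψ x ^ 2) :=
    ((hf.lap.continuous.pow 2).mul (hψ.continuous.pow 2)).integrable_of_hasCompactSupport
      hc.fun_sq.mul_left
  have i3 : Integrable (fun x => lap (fun y => f y * ψ y) x ^ 2) :=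
    (hfψ.lap.continuous.pow 2).integrable_of_hasCompactSupport hc'.lap.fun_sq
  have i4 : Integrable (fun x => 12 * (gradSq f x * gradSq ψ x) + 3 * cutoffError f ψ x) :=
    (i1.const_mul 12).add (i0.const_mul 3)
  have key : ∫ x, lap f x ^ 2 * ψ x ^ 2 ≤
      ∫ x, (3 * lap (fun y => f y * ψ y) x ^ 2
        + (12 * (gradSq f x * gradSq ψ x) + 3 * cutoffError f ψ x)) := by
    refine integral_mono i2 ((i3.const_mul 3).add i4)
      fun x => ?_
    have hCS := sq_sum_pderivE_mul_le f ψ x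
    have e1 := mul_nonneg (abs_nonneg (f x * lap f x)) (gradSq_nonneg ψ x)
    have e3 := mul_nonneg (sq_nonneg (f x)) (abs_nonneg (lap (gradSq ψ) x))
    simp only [cutoffError]
    have hw : ψ x * lap f x = lap (fun y => f y * ψ y) x
        - 2 * (∑ i, pderivE i f x * pderivE i ψ x) - f x * lap ψ x := by
      rw [lap_mul hf hψ]
      ring
    have hw2 : lap f x ^ 2 * ψ x ^ 2 = (ψ x * lap f x) ^ 2 := by ring
    rw [hw2, hw]
    set Γ := ∑ i, pderivE i f x * pderivE i ψ x
    set L := lap (fun y => f y * ψ y) x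
    linarith [sq_nonneg (L + 2 * Γ), sq_nonneg (L + f x * lap ψ x),
      sq_nonneg (2 * Γ - f x * lap ψ x)]
  rw [integral_add (i3.const_mul 3) i4,
    integral_add (i1.const_mul 12) (i0.const_mul 3), integral_const_mul, integral_const_mul,
    integral_const_mul] at key
  have h4 := integral_gradSq_mul_gradSq_le hf hψ hc
  linarith

lemma norm_rpow_sub_one_mul_sq {m : ℕ} {p : ℝ} (hp : 1 < p) (v : EuclideanSpace ℝ (Fin m)) :
    ‖v‖ ^ (p - 1) * ∑ i, v i ^ 2 = ‖v‖ ^ (p + 1) := by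
  rw [← EuclideanSpace.real_norm_sq_eq, ← Real.rpow_natCast,
    ← Real.rpow_add_of_nonneg (norm_nonneg v) (by linarith) (by norm_num)]
  congr 1
  push_cast
  ring

lemma norm_rpow_sub_three_mul_sq_mul_sq {m : ℕ} {p : ℝ} (hp : 1 < p)
    (v : EuclideanSpace ℝ (Fin m)) :
    ‖v‖ ^ (p - 3) * ((∑ i, v i ^ 2) * ∑ i, v i ^ 2) = ‖v‖ ^ (p + 1) := by
  rcases eq_or_ne v 0 with rfl | hv
  · simp [Real.zero_rpow (by linarith : p + 1 ≠ 0)]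
  · rw [← EuclideanSpace.real_norm_sq_eq, ← pow_add, ← Real.rpow_natCast,
      ← Real.rpow_add (norm_pos_iff.2 hv)]
    congr 1
    push_cast
    ring

lemma integrable_mul_sq {n : ℕ} {f ψ : Euc n → ℝ} (hf : Continuous f) (hψ : Continuous ψ)
    (hc : HasCompactSupport ψ) : Integrable (fun x => f x * ψ x ^ 2) :=
  (hf.mul (hψ.pow 2)).integrable_of_hasCompactSupport hc.fun_sq.mul_left

lemma sum_sum_integral_stability_term {n m : ℕ} {p : ℝ} (hp : 1 < p)
    {u : Euc n → EuclideanSpace ℝ (Fin m)} (hu : Continuous u) {ψ : Euc n → ℝ}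
    (hψ : Continuous ψ) (hc : HasCompactSupport ψ) :
    ∑ i, ∑ j, ∫ x, ‖u x‖ ^ (p - 3) * u x i * u x j * (u x i * ψ x) * (u x j * ψ x)
      = ∫ x, ‖u x‖ ^ (p + 1) * ψ x ^ 2 := by
  have hui : ∀ i, Continuous fun x => u x i := fun i => by fun_prop
  have hY : Integrable (fun x => ‖u x‖ ^ (p + 1) * ψ x ^ 2) :=
    integrable_mul_sq (hu.norm.rpow_const fun _ => Or.inr (by linarith)) hψ hc
  have hint : ∀ i j, Integrable
      (fun x => ‖u x‖ ^ (p - 3) * u x i * u x j * (u x i * ψ x) * (u x j * ψ x)) := by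
    intro i j
    refine hY.mono' ?_ (ae_of_all _ fun x => ?_)
    · have hm := hu.norm.measurable.pow_const (p - 3)
      have h1 := (hui i).measurable
      have h2 := (hui j).measurable
      have h3 := hψ.measurable
      exact Measurable.aestronglyMeasurable (by fun_prop)
    · have hnn := Real.rpow_nonneg (norm_nonneg (u x)) (p - 3)
      have e : ‖u x‖ ^ (p - 3) * u x i * u x j * (u x i * ψ x) * (u x j * ψ x)
          = ‖u x‖ ^ (p - 3) * (u x i ^ 2 * u x j ^ 2) * ψ x ^ 2 := by ring
      rw [e, Real.norm_of_nonneg (by positivity), ← norm_rpow_sub_three_mul_sq_mul_sq hp]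
      have hs : ∀ k, u x k ^ 2 ≤ ∑ i, u x i ^ 2 := fun k =>
        Finset.single_le_sum (f := fun i => u x i ^ 2) (fun i _ => sq_nonneg _)
          (Finset.mem_univ k)
      have hss := mul_le_mul (hs i) (hs j) (sq_nonneg _) ((sq_nonneg _).trans (hs i))
      gcongr
  have hswap : ∀ i, ∑ j, ∫ x, ‖u x‖ ^ (p - 3) * u x i * u x j * (u x i * ψ x) * (u x j * ψ x)
      = ∫ x, ∑ j, ‖u x‖ ^ (p - 3) * u x i * u x j * (u x i * ψ x) * (u x j * ψ x) :=
    fun i => (integral_finsetSum _ fun j _ => hint i j).symm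
  simp only [hswap]
  rw [← integral_finsetSum _ fun i _ => integrable_finsetSum _ fun j _ => hint i j]
  congr 1
  funext x
  rw [← norm_rpow_sub_three_mul_sq_mul_sq hp, Finset.sum_mul_sum]
  simp only [Finset.mul_sum, Finset.sum_mul]
  refine Finset.sum_congr rfl fun i _ => Finset.sum_congr rfl fun j _ => ?_
  ring

lemma sum_integral_norm_rpow_mul {n m : ℕ} {p : ℝ} (hp : 1 < p)
    {u : Euc n → EuclideanSpace ℝ (Fin m)} (hu : Continuous u) {ψ : Euc n → ℝ}
    (hψ : Continuous ψ) (hc : HasCompactSupport ψ) :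
    ∑ i, ∫ x, ‖u x‖ ^ (p - 1) * (u x i * ψ x) ^ 2 = ∫ x, ‖u x‖ ^ (p + 1) * ψ x ^ 2 := by
  have hn : Continuous fun x => ‖u x‖ ^ (p - 1) :=
    hu.norm.rpow_const fun _ => Or.inr (by linarith)
  have hui : ∀ i, Continuous fun x => u x i := fun i => by fun_prop
  have hint : ∀ i, Integrable (fun x => ‖u x‖ ^ (p - 1) * u x i ^ 2 * ψ x ^ 2) :=
    fun i => integrable_mul_sq (hn.mul ((hui i).pow 2)) hψ hc
  simp only [mul_pow, ← mul_assoc]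
  rw [← integral_finsetSum _ fun i _ => hint i]
  congr 1
  funext x
  rw [← norm_rpow_sub_one_mul_sq hp, Finset.mul_sum, Finset.sum_mul]

/-- The error density for a vector-valued function `u` localised with `ψ`. -/
def vectorCutoffError {n m : ℕ} (u : Euc n → EuclideanSpace ℝ (Fin m)) (ψ : Euc n → ℝ)
    (x : Euc n) : ℝ :=
  ‖u x‖ ^ 2 * (|lap (gradSq ψ) x| + lap ψ x ^ 2) +
    ‖u x‖ * √(∑ i, lap (fun y => u y i) x ^ 2) * gradSq ψ x

lemma sum_cutoffError_le {n m : ℕ} (u : Euc n → EuclideanSpace ℝ (Fin m)) (ψ : Euc n → ℝ)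
    (x : Euc n) :
    ∑ i, cutoffError (fun y => u y i) ψ x ≤ vectorCutoffError u ψ x := by
  have hCS : ∑ i, |u x i * lap (fun y => u y i) x|
      ≤ ‖u x‖ * √(∑ i, lap (fun y => u y i) x ^ 2) := by
    rw [EuclideanSpace.norm_eq]
    simpa only [abs_mul, sq_abs, Real.norm_eq_abs] using
      Real.sum_mul_le_sqrt_mul_sqrt Finset.univ (fun i => |u x i|)
        (fun i => |lap (fun y => u y i) x|)
  simp only [cutoffError, vectorCutoffError, Finset.sum_add_distrib, ← Finset.sum_mul]
  rw [EuclideanSpace.real_norm_sq_eq]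
  gcongr
  exact gradSq_nonneg ψ x

lemma continuous_sqrt_sum_lap_sq {n m : ℕ} {u : Euc n → EuclideanSpace ℝ (Fin m)}
    (hu : ContDiff ℝ (⊤ : ℕ∞) u) :
    Continuous fun x => √(∑ i, lap (fun y => u y i) x ^ 2) := by
  have hw : ∀ i, Continuous (lap fun x => u x i) :=
    fun i => (contDiff_euclidean.1 hu i).lap.continuous
  fun_prop

lemma integrable_vectorCutoffError {n m : ℕ} {u : Euc n → EuclideanSpace ℝ (Fin m)}
    (hu : ContDiff ℝ (⊤ : ℕ∞) u) {ψ : Euc n → ℝ} (hψ : ContDiff ℝ (⊤ : ℕ∞) ψ)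
    (hc : HasCompactSupport ψ) : Integrable (vectorCutoffError u ψ) := by
  have hL := hψ.lap.continuous
  have hG := hψ.gradSq.continuous
  have hLG := hψ.gradSq.lap.continuous
  have hw := continuous_sqrt_sum_lap_sq hu
  have hu' := hu.continuous
  have hcG := hasCompactSupport_gradSq hc
  refine Continuous.integrable_of_hasCompactSupport (by unfold vectorCutoffError; fun_prop) ?_
  refine HasCompactSupport.add (HasCompactSupport.mul_left (HasCompactSupport.add ?_ ?_))
    hcG.mul_left
  · exact hcG.lap.comp_left (g := fun t : ℝ => |t|) (by simp)
  · exact hc.lap.fun_sq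

/-- The Caccioppoli-type inequality for stable solutions with a general cutoff function. -/
lemma Stable2.integral_energy_mul_sq_le {n m : ℕ} {p : ℝ} (hp : 1 < p)
    {u : Euc n → EuclideanSpace ℝ (Fin m)} (hu : ContDiff ℝ (⊤ : ℕ∞) u)
    (hsol : ∀ (i : Fin m) (x : Euc n),
      lap (fun z => lap (fun w => u w i) z) x = ‖u x‖ ^ (p - 1) * u x i)
    (hstab : Stable2 n m p u Set.univ) {ψ : Euc n → ℝ} (hψ : ContDiff ℝ (⊤ : ℕ∞) ψ)
    (hc : HasCompactSupport ψ) :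
    ∫ x, (√(∑ i, lap (fun y => u y i) x ^ 2) ^ 2 + ‖u x‖ ^ (p + 1)) * ψ x ^ 2
      ≤ (40 / (p - 1) + 45) * ∫ x, vectorCutoffError u ψ x := by
  have hui : ∀ i, ContDiff ℝ (⊤ : ℕ∞) fun x => u x i := fun i => contDiff_euclidean.1 hu i
  have hcont := hu.continuous
  have hstab' := hstab (fun i x => u x i * ψ x) (fun i => (hui i).mul hψ)
    (fun i => hc.mul_left) (fun i => Set.subset_univ _)
  rw [sum_sum_integral_stability_term hp hcont hψ.continuous hc,
    sum_integral_norm_rpow_mul hp hcont hψ.continuous hc] at hstab'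
  have hsolY : ∑ i, ∫ x, lap (lap fun y => u y i) x * (u x i * ψ x ^ 2)
      = ∫ x, ‖u x‖ ^ (p + 1) * ψ x ^ 2 := by
    rw [← sum_integral_norm_rpow_mul hp hcont hψ.continuous hc]
    refine Finset.sum_congr rfl fun i _ => ?_
    congr 1
    funext x
    rw [show lap (lap fun y => u y i) x = _ from hsol i x]
    ring
  have hL := Finset.sum_le_sum fun i (_ : i ∈ Finset.univ) => integral_lap_mul_sq_le (hui i) hψ hc
  have hX := Finset.sum_le_sum fun i (_ : i ∈ Finset.univ) =>
    integral_lap_sq_mul_sq_le (hui i) hψ hc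
  simp only [Finset.sum_add_distrib, ← Finset.mul_sum] at hL hX
  rw [hsolY] at hL
  have hE : ∑ i, ∫ x, cutoffError (fun y => u y i) ψ x ≤ ∫ x, vectorCutoffError u ψ x := by
    rw [← integral_finsetSum _ fun i _ => integrable_cutoffError (hui i) hψ hc]
    exact integral_mono (integrable_finsetSum _ fun i _ => integrable_cutoffError (hui i) hψ hc)
      (integrable_vectorCutoffError hu hψ hc) (sum_cutoffError_le u ψ)
  have hY : Integrable (fun x => ‖u x‖ ^ (p + 1) * ψ x ^ 2) :=
    integrable_mul_sq (hcont.norm.rpow_const fun _ => Or.inr (by linarith)) hψ.continuous hc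
  have hW : ∀ i, Integrable (fun x => lap (fun y => u y i) x ^ 2 * ψ x ^ 2) := fun i =>
    integrable_mul_sq ((hui i).lap.continuous.pow 2) hψ.continuous hc
  have hsplit : ∫ x, (√(∑ i, lap (fun y => u y i) x ^ 2) ^ 2 + ‖u x‖ ^ (p + 1)) * ψ x ^ 2
      = (∑ i, ∫ x, lap (fun y => u y i) x ^ 2 * ψ x ^ 2) + ∫ x, ‖u x‖ ^ (p + 1) * ψ x ^ 2 := by
    rw [← integral_finsetSum _ fun i _ => hW i,
      ← integral_add (integrable_finsetSum _ fun i _ => hW i) hY]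
    congr 1
    funext x
    rw [Real.sq_sqrt (Finset.sum_nonneg fun i _ => sq_nonneg _), add_mul, Finset.sum_mul]
  rw [hsplit]
  set Y := ∫ x, ‖u x‖ ^ (p + 1) * ψ x ^ 2
  set E := ∫ x, vectorCutoffError u ψ x
  have hY4 : 4 * Y ≤ 40 / (p - 1) * E := by
    rw [div_mul_eq_mul_div, le_div_iff₀ (by linarith)]
    linarith
  linarith

/-- `g` is a smooth multiple of the `k`-th power of `η`. -/
def IsSmoothMulPow {n : ℕ} (η : Euc n → ℝ) (k : ℕ) (g : Euc n → ℝ) : Prop :=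
  ∃ h : Euc n → ℝ, ContDiff ℝ (⊤ : ℕ∞) h ∧ g = fun x => η x ^ k * h x

lemma isSmoothMulPow_pow {n : ℕ} (η : Euc n → ℝ) (k : ℕ) :
    IsSmoothMulPow η k (fun x => η x ^ k) :=
  ⟨fun _ => 1, contDiff_const, by simp⟩

lemma IsSmoothMulPow.mul {n : ℕ} {η f g : Euc n → ℝ} {k l : ℕ} (hf : IsSmoothMulPow η k f)
    (hg : IsSmoothMulPow η l g) : IsSmoothMulPow η (k + l) (fun x => f x * g x) := by
  obtain ⟨a, ha, rfl⟩ := hf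
  obtain ⟨b, hb, rfl⟩ := hg
  exact ⟨fun x => a x * b x, ha.mul hb, by funext x; ring⟩

lemma IsSmoothMulPow.sum {n : ℕ} {ι : Type*} [Fintype ι] {η : Euc n → ℝ} {f : ι → Euc n → ℝ}
    {k : ℕ} (hf : ∀ i, IsSmoothMulPow η k (f i)) :
    IsSmoothMulPow η k (fun x => ∑ i, f i x) := by
  choose a ha hfa using hf
  refine ⟨fun x => ∑ i, a i x, ContDiff.sum fun i _ => ha i, ?_⟩
  funext x
  simp only [hfa, Finset.mul_sum]

lemma IsSmoothMulPow.pderivE {n : ℕ} {η g : Euc n → ℝ} (hη : ContDiff ℝ (⊤ : ℕ∞) η) {k : ℕ}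
    (hg : IsSmoothMulPow η (k + 1) g) (i : Fin n) : IsSmoothMulPow η k (pderivE i g) := by
  obtain ⟨a, ha, rfl⟩ := hg
  refine ⟨fun x => η x * _root_.pderivE i a x + (k + 1) * (a x * _root_.pderivE i η x),
    (hη.mul (ha.pderivE i)).add (contDiff_const.mul (ha.mul (hη.pderivE i))), ?_⟩
  rw [pderivE_mul (hη.pow (k + 1)) ha]
  funext x
  have hpow : _root_.pderivE i (fun x => η x ^ (k + 1)) x
      = (k + 1) * η x ^ k * _root_.pderivE i η x := by
    simp only [_root_.pderivE]
    rw [fderiv_fun_pow (k + 1) (hη.differentiable (by simp) x)]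
    simp
  rw [hpow]
  ring

lemma IsSmoothMulPow.gradSq {n : ℕ} {η g : Euc n → ℝ} (hη : ContDiff ℝ (⊤ : ℕ∞) η) {k : ℕ}
    (hg : IsSmoothMulPow η (k + 1) g) : IsSmoothMulPow η (k + k) (gradSq g) :=
  IsSmoothMulPow.sum fun i => (hg.pderivE hη i).mul (hg.pderivE hη i)

lemma IsSmoothMulPow.contDiff {n : ℕ} {η g : Euc n → ℝ} (hη : ContDiff ℝ (⊤ : ℕ∞) η) {k : ℕ}
    (hg : IsSmoothMulPow η k g) : ContDiff ℝ (⊤ : ℕ∞) g := by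
  obtain ⟨a, ha, rfl⟩ := hg
  exact (hη.pow k).mul ha

lemma IsSmoothMulPow.lap {n : ℕ} {η g : Euc n → ℝ} (hη : ContDiff ℝ (⊤ : ℕ∞) η) {k : ℕ}
    (hg : IsSmoothMulPow η (k + 2) g) : IsSmoothMulPow η k (lap g) := by
  rw [lap_eq_sum_pderivE (hg.contDiff hη)]
  exact IsSmoothMulPow.sum fun i => (hg.pderivE hη i).pderivE hη i

lemma IsSmoothMulPow.exists_abs_le {n : ℕ} {η g : Euc n → ℝ} (hc : HasCompactSupport η)
    (h0 : ∀ x, 0 ≤ η x) {k : ℕ} (hk : k ≠ 0) (hg : IsSmoothMulPow η k g) :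
    ∃ C, 0 ≤ C ∧ ∀ x, |g x| ≤ C * η x ^ k := by
  obtain ⟨a, ha, rfl⟩ := hg
  obtain ⟨C, hC⟩ := hc.isCompact.exists_bound_of_continuousOn ha.continuous.continuousOn
  refine ⟨|C|, abs_nonneg C, fun x => ?_⟩
  by_cases hx : x ∈ tsupport η
  · rw [abs_mul, abs_of_nonneg (pow_nonneg (h0 x) k), mul_comm]
    exact mul_le_mul_of_nonneg_right ((hC x hx).trans (le_abs_self C)) (pow_nonneg (h0 x) k)
  · simp [image_eq_zero_of_notMem_tsupport hx, hk]

lemma pderivE_comp_smul_sub {n : ℕ} {g : Euc n → ℝ} (hg : ContDiff ℝ (⊤ : ℕ∞) g) (r : ℝ)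
    (x : Euc n) (i : Fin n) :
    pderivE i (fun z => g (r • (z - x))) = fun z => r * pderivE i g (r • (z - x)) := by
  funext z
  have h1 : HasFDerivAt (fun z : Euc n => r • (z - x)) (r • ContinuousLinearMap.id ℝ (Euc n)) z :=
    ((hasFDerivAt_id z).sub_const x).const_smul r
  have h2 := (hg.differentiable (by simp) (r • (z - x))).hasFDerivAt.comp z h1
  simp only [pderivE]
  rw [show (fun z => g (r • (z - x))) = g ∘ fun z => r • (z - x) from rfl, h2.fderiv]
  simp

lemma pderivE_const_mul {n : ℕ} {g : Euc n → ℝ} (hg : ContDiff ℝ (⊤ : ℕ∞) g) (c : ℝ)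
    (i : Fin n) : pderivE i (fun z => c * g z) = fun z => c * pderivE i g z := by
  rw [pderivE_mul contDiff_const hg]
  funext x
  simp [pderivE]

lemma lap_const_mul {n : ℕ} {g : Euc n → ℝ} (hg : ContDiff ℝ (⊤ : ℕ∞) g) (c : ℝ) (z : Euc n) :
    lap (fun z => c * g z) z = c * lap g z := by
  rw [lap_eq_sum_pderivE (contDiff_const.mul hg), lap_eq_sum_pderivE hg]
  simp only [Finset.mul_sum]
  refine Finset.sum_congr rfl fun i _ => ?_
  rw [pderivE_const_mul hg, pderivE_const_mul (hg.pderivE i)]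

lemma contDiff_comp_smul_sub {n : ℕ} {g : Euc n → ℝ} (hg : ContDiff ℝ (⊤ : ℕ∞) g) (r : ℝ)
    (x : Euc n) : ContDiff ℝ (⊤ : ℕ∞) (fun z => g (r • (z - x))) :=
  hg.comp ((contDiff_id.sub contDiff_const).const_smul r)

lemma lap_comp_smul_sub {n : ℕ} {g : Euc n → ℝ} (hg : ContDiff ℝ (⊤ : ℕ∞) g) (r : ℝ)
    (x z : Euc n) : lap (fun z => g (r • (z - x))) z = r ^ 2 * lap g (r • (z - x)) := by
  rw [lap_eq_sum_pderivE (contDiff_comp_smul_sub hg r x), lap_eq_sum_pderivE hg]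
  simp only [Finset.mul_sum]
  refine Finset.sum_congr rfl fun i _ => ?_
  rw [pderivE_comp_smul_sub hg, pderivE_const_mul (contDiff_comp_smul_sub (hg.pderivE i) r x),
    pderivE_comp_smul_sub (hg.pderivE i)]
  ring

lemma gradSq_comp_smul_sub {n : ℕ} {g : Euc n → ℝ} (hg : ContDiff ℝ (⊤ : ℕ∞) g) (r : ℝ)
    (x : Euc n) :
    gradSq (fun z => g (r • (z - x))) = fun z => r ^ 2 * gradSq g (r • (z - x)) := by
  funext z
  simp only [gradSq, Finset.mul_sum, pderivE_comp_smul_sub hg]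
  refine Finset.sum_congr rfl fun i _ => ?_
  ring

lemma pderivE_eq_zero_of_eqOn {n : ℕ} {f : Euc n → ℝ} {s : Set (Euc n)} (hs : IsOpen s) {c : ℝ}
    (hf : ∀ z ∈ s, f z = c) {z : Euc n} (hz : z ∈ s) (i : Fin n) : pderivE i f z = 0 := by
  have h : f =ᶠ[nhds z] fun _ => c := by
    filter_upwards [hs.mem_nhds hz] with y hy using hf y hy
  rw [pderivE, h.fderiv_eq]
  simp

lemma gradSq_eq_zero_of_eqOn {n : ℕ} {f : Euc n → ℝ} {s : Set (Euc n)} (hs : IsOpen s) {c : ℝ}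
    (hf : ∀ z ∈ s, f z = c) {z : Euc n} (hz : z ∈ s) : gradSq f z = 0 := by
  simp [gradSq, pderivE_eq_zero_of_eqOn hs hf hz]

lemma lap_eq_zero_of_eqOn {n : ℕ} {f : Euc n → ℝ} (h : ContDiff ℝ (⊤ : ℕ∞) f)
    {s : Set (Euc n)} (hs : IsOpen s) {c : ℝ}
    (hf : ∀ z ∈ s, f z = c) {z : Euc n} (hz : z ∈ s) : lap f z = 0 := by
  rw [lap_eq_sum_pderivE h]
  exact Finset.sum_eq_zero fun i _ => pderivE_eq_zero_of_eqOn hs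
    (fun y hy => pderivE_eq_zero_of_eqOn hs hf hy i) hz i

/-- Cutoff functions between concentric balls of radii `R` and `2R`, whose high powers have
derivatives controlled by lower powers. -/
lemma exists_cutoff (n : ℕ) {k : ℕ} (hk : k ≠ 0) :
    ∃ C : ℝ, 0 < C ∧ ∀ (R : ℝ) (x : Euc n), 0 < R → ∃ η : Euc n → ℝ,
      ContDiff ℝ (⊤ : ℕ∞) η ∧ HasCompactSupport η ∧ (∀ z, 0 ≤ η z) ∧ (∀ z, η z ≤ 1) ∧
      (∀ z ∈ ball x R, η z = 1) ∧ (∀ z ∉ ball x (2 * R), η z = 0) ∧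
      (∀ z ∈ ball x R, gradSq (fun y => η y ^ (k + 2)) z = 0 ∧
        |lap (gradSq (fun y => η y ^ (k + 2))) z| + lap (fun y => η y ^ (k + 2)) z ^ 2 = 0) ∧
      (∀ z, gradSq (fun y => η y ^ (k + 2)) z ≤ C * R⁻¹ ^ 2 * η z ^ (2 * k + 2)) ∧
      (∀ z, |lap (gradSq (fun y => η y ^ (k + 2))) z| + lap (fun y => η y ^ (k + 2)) z ^ 2
        ≤ C * R⁻¹ ^ 4 * η z ^ (2 * k)) := by
  let b : ContDiffBump (0 : Euc n) := ⟨1, 2, one_pos, one_lt_two⟩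
  have hb : ContDiff ℝ (⊤ : ℕ∞) b := b.contDiff
  have hcb : HasCompactSupport b := b.hasCompactSupport
  have hb0 : ∀ x, 0 ≤ b x := fun x => b.nonneg
  have hP := isSmoothMulPow_pow (b : Euc n → ℝ) (k + 2)
  have hG : IsSmoothMulPow b (2 * k + 2) (gradSq fun y => b y ^ (k + 2)) := by
    have := IsSmoothMulPow.gradSq hb (k := k + 1) hP
    rwa [show k + 1 + (k + 1) = 2 * k + 2 by ring] at this
  obtain ⟨C₁, hC₁, h₁⟩ := hG.exists_abs_le hcb hb0 (by omega)
  obtain ⟨C₂, hC₂, h₂⟩ := (hG.lap hb).exists_abs_le hcb hb0 (by omega)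
  obtain ⟨C₃, hC₃, h₃⟩ := (hP.lap hb).exists_abs_le hcb hb0 hk
  have hPs : ContDiff ℝ (⊤ : ℕ∞) (fun y => b y ^ (k + 2)) := hb.pow _
  refine ⟨C₁ + C₂ + C₃ ^ 2 + 1, by positivity, fun R x hR => ?_⟩
  have hdist : ∀ z, dist (R⁻¹ • (z - x)) 0 = dist z x / R := fun z => by
    rw [dist_zero_right, norm_smul, norm_inv, Real.norm_of_nonneg hR.le, ← dist_eq_norm,
      inv_mul_eq_div]
  have hone : ∀ z ∈ ball x R, b (R⁻¹ • (z - x)) = 1 := fun z hz => by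
    refine b.one_of_mem_closedBall ?_
    rw [mem_closedBall, hdist, div_le_iff₀ hR]
    simpa [b] using (mem_ball.1 hz).le
  have hzero : ∀ z ∉ ball x (2 * R), b (R⁻¹ • (z - x)) = 0 := fun z hz => by
    refine b.zero_of_le_dist ?_
    rw [hdist, le_div_iff₀ hR]
    simpa [b] using hz
  refine ⟨fun z => b (R⁻¹ • (z - x)), contDiff_comp_smul_sub hb _ x, ?_, fun z => b.nonneg,
    fun z => b.le_one, hone, hzero, fun z hz => ?_, fun z => ?_, fun z => ?_⟩
  · exact HasCompactSupport.intro (isCompact_closedBall x (2 * R))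
      fun z hz => hzero z fun h => hz (ball_subset_closedBall h)
  · have hone' : ∀ z ∈ ball x R, b (R⁻¹ • (z - x)) ^ (k + 2) = 1 := fun z hz => by
      rw [hone z hz, one_pow]
    have hs := contDiff_comp_smul_sub hPs R⁻¹ x
    refine ⟨gradSq_eq_zero_of_eqOn isOpen_ball hone' hz, ?_⟩
    rw [lap_eq_zero_of_eqOn hs isOpen_ball hone' hz, lap_eq_zero_of_eqOn hs.gradSq isOpen_ball
      (fun y hy => gradSq_eq_zero_of_eqOn isOpen_ball hone' hy) hz]
    simp
  · rw [gradSq_comp_smul_sub hPs]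
    have hle := (le_abs_self _).trans (h₁ (R⁻¹ • (z - x)))
    have hpow : 0 ≤ b (R⁻¹ • (z - x)) ^ (2 * k + 2) := pow_nonneg b.nonneg _
    calc R⁻¹ ^ 2 * gradSq (fun y => b y ^ (k + 2)) (R⁻¹ • (z - x))
        ≤ R⁻¹ ^ 2 * (C₁ * b (R⁻¹ • (z - x)) ^ (2 * k + 2)) := by gcongr
      _ = C₁ * (R⁻¹ ^ 2 * b (R⁻¹ • (z - x)) ^ (2 * k + 2)) := by ring
      _ ≤ (C₁ + C₂ + C₃ ^ 2 + 1) * (R⁻¹ ^ 2 * b (R⁻¹ • (z - x)) ^ (2 * k + 2)) := by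
          refine mul_le_mul_of_nonneg_right (by nlinarith) (by positivity)
      _ = _ := by ring
  · rw [gradSq_comp_smul_sub hPs, lap_const_mul (contDiff_comp_smul_sub hPs.gradSq _ x),
      lap_comp_smul_sub hPs.gradSq, lap_comp_smul_sub hPs]
    set y := R⁻¹ • (z - x)
    have hpow : 0 ≤ b y ^ (2 * k) := pow_nonneg b.nonneg _
    have e₂ := h₂ y
    have e₃ : lap (fun y => b y ^ (k + 2)) y ^ 2 ≤ C₃ ^ 2 * b y ^ (2 * k) := by
      rw [← sq_abs]
      calc |lap (fun y => b y ^ (k + 2)) y| ^ 2 ≤ (C₃ * b y ^ k) ^ 2 := by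
            gcongr
            exact h₃ y
        _ = _ := by ring
    calc |R⁻¹ ^ 2 * (R⁻¹ ^ 2 * lap (gradSq fun y => b y ^ (k + 2)) y)|
          + (R⁻¹ ^ 2 * lap (fun y => b y ^ (k + 2)) y) ^ 2
        = R⁻¹ ^ 4 * (|lap (gradSq fun y => b y ^ (k + 2)) y|
          + lap (fun y => b y ^ (k + 2)) y ^ 2) := by
          rw [abs_mul, abs_mul, abs_of_nonneg (by positivity : 0 ≤ R⁻¹ ^ 2)]
          ring
      _ ≤ R⁻¹ ^ 4 * (C₂ * b y ^ (2 * k) + C₃ ^ 2 * b y ^ (2 * k)) := by gcongr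
      _ = (C₂ + C₃ ^ 2) * (R⁻¹ ^ 4 * b y ^ (2 * k)) := by ring
      _ ≤ (C₁ + C₂ + C₃ ^ 2 + 1) * (R⁻¹ ^ 4 * b y ^ (2 * k)) := by
          refine mul_le_mul_of_nonneg_right (by linarith) (by positivity)
      _ = _ := by ring

/-- Young's inequality absorbing the lower-order terms into the energy density. -/
lemma exists_absorb_le {p : ℝ} (hp : 1 < p) {D : ℝ} (hD : 0 < D) {k : ℕ}
    (hk : 4 / (p - 1) ≤ k) :
    ∃ M : ℝ, 0 < M ∧ ∀ a b t ρ : ℝ, 0 ≤ a → 0 ≤ b → 0 ≤ t → t ≤ 1 → 0 < ρ →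
      D * (a ^ 2 * (ρ ^ 4 * t ^ (2 * k)) + a * b * (ρ ^ 2 * t ^ (2 * k + 2)))
        ≤ max (1 / 2) (2 / (p + 1)) * ((b ^ 2 + a ^ (p + 1)) * (t ^ (k + 2)) ^ 2)
          + M * ρ ^ (4 * (p + 1) / (p - 1)) := by
  have hp1 : 0 < p - 1 := by linarith
  have hconj : ((p + 1) / 2).HolderConjugate ((p + 1) / (p - 1)) := by
    rw [Real.holderConjugate_iff]
    refine ⟨by linarith, ?_⟩
    field_simp
    ring
  set s := (p + 1) / 2 with hs
  set s' := (p + 1) / (p - 1) with hs'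
  have hspos : 0 < s := by positivity
  have hs'pos : 0 < s' := by positivity
  set N := D + D ^ 2 / 2 with hN
  have hNpos : 0 < N := by positivity
  refine ⟨N ^ s' / s', by positivity, fun a b t ρ ha hb ht ht1 hρ => ?_⟩
  have hsq : D * (a * b * (ρ ^ 2 * t ^ (2 * k + 2)))
      ≤ 1 / 2 * (b ^ 2 * (t ^ (k + 2)) ^ 2) + D ^ 2 / 2 * (a ^ 2 * (ρ ^ 4 * t ^ (2 * k))) := by
    have := sq_nonneg (b * t ^ (k + 2) - D * (a * ρ ^ 2 * t ^ k))
    have e : (b * t ^ (k + 2) - D * (a * ρ ^ 2 * t ^ k)) ^ 2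
        = b ^ 2 * (t ^ (k + 2)) ^ 2 + D ^ 2 * (a ^ 2 * (ρ ^ 4 * t ^ (2 * k)))
          - 2 * (D * (a * b * (ρ ^ 2 * t ^ (2 * k + 2)))) := by ring
    linarith
  have hyoung := Real.young_inequality_of_nonneg (a := a ^ 2 * t ^ (2 * k)) (b := N * ρ ^ 4)
    (by positivity) (by positivity) hconj
  have hfirst : (a ^ 2 * t ^ (2 * k)) ^ s ≤ a ^ (p + 1) * (t ^ (k + 2)) ^ 2 := by
    have ea : (a ^ 2) ^ s = a ^ (p + 1) := by
      rw [← Real.rpow_natCast, ← Real.rpow_mul ha, hs]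
      congr 1
      push_cast
      ring
    rw [Real.mul_rpow (by positivity) (by positivity), ea]
    refine mul_le_mul_of_nonneg_left ?_ (Real.rpow_nonneg ha _)
    rw [← pow_mul, ← Real.rpow_natCast t (2 * k), ← Real.rpow_mul ht]
    have hkk : (4 : ℝ) ≤ k * (p - 1) := (div_le_iff₀ hp1).1 hk
    have hexp : (((k + 2) * 2 : ℕ) : ℝ) ≤ ((2 * k : ℕ) : ℝ) * s := by
      rw [hs]
      push_cast
      linarith
    rw [← Real.rpow_natCast t ((k + 2) * 2)]
    exact Real.rpow_le_rpow_of_exponent_ge' ht ht1 (Nat.cast_nonneg _) hexp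
  have hsecond : (N * ρ ^ 4) ^ s' = N ^ s' * ρ ^ (4 * (p + 1) / (p - 1)) := by
    rw [Real.mul_rpow hNpos.le (by positivity), ← Real.rpow_natCast, ← Real.rpow_mul hρ.le, hs']
    congr 2
    push_cast
    ring
  rw [hsecond] at hyoung
  have hθ₁ : 1 / 2 * (b ^ 2 * (t ^ (k + 2)) ^ 2)
      ≤ max (1 / 2) (2 / (p + 1)) * (b ^ 2 * (t ^ (k + 2)) ^ 2) :=
    mul_le_mul_of_nonneg_right (le_max_left _ _) (by positivity)
  have hθ₂ : (a ^ 2 * t ^ (2 * k)) ^ s / s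
      ≤ max (1 / 2) (2 / (p + 1)) * (a ^ (p + 1) * (t ^ (k + 2)) ^ 2) := by
    calc (a ^ 2 * t ^ (2 * k)) ^ s / s ≤ a ^ (p + 1) * (t ^ (k + 2)) ^ 2 / s := by gcongr
      _ = 2 / (p + 1) * (a ^ (p + 1) * (t ^ (k + 2)) ^ 2) := by
        rw [hs]
        field_simp
      _ ≤ _ := mul_le_mul_of_nonneg_right (le_max_right _ _)
        (mul_nonneg (Real.rpow_nonneg ha _) (by positivity))
  have e1 : D * (a ^ 2 * (ρ ^ 4 * t ^ (2 * k))) + D ^ 2 / 2 * (a ^ 2 * (ρ ^ 4 * t ^ (2 * k)))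
      = a ^ 2 * t ^ (2 * k) * (N * ρ ^ 4) := by
    rw [hN]
    ring
  have e2 : N ^ s' * ρ ^ (4 * (p + 1) / (p - 1)) / s'
      = N ^ s' / s' * ρ ^ (4 * (p + 1) / (p - 1)) := by ring
  linarith

lemma measureReal_ball_two_mul (n : ℕ) (x : Euc n) {R : ℝ} (hR : 0 < R) :
    volume.real (ball x (2 * R)) = R ^ n * volume.real (ball (0 : Euc n) 2) := by
  rw [mul_comm 2 R, measureReal_def, Measure.addHaar_ball_mul_of_pos volume x hR,
    ENNReal.toReal_mul, ENNReal.toReal_ofReal (by positivity), finrank_euclideanSpace_fin,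
    measureReal_def]

/-- Corollary 3.3: for smooth stable solutions of `Δ²u_i = |u|^{p−1} u_i`, with
`w_i = Δu_i` and `|w| = (Σ_i w_i²)^{1/2}`, one has
`∫_{B_R(x)} (|w|² + |u|^{p+1}) ≤ C R^{−4} ∫_{B_{2R}(x)∖B_R(x)} |u|²
  + C R^{−2} ∫_{B_{2R}(x)∖B_R(x)} |u||w|` for every `R > 0` and `x`, and consequently
`∫_{B_R(x)} (|w|² + |u|^{p+1}) ≤ C R^{n−4(p+1)/(p−1)}` for all `R ≥ 1`. -/
theorem statement12 (n m : ℕ) (hn : 1 ≤ n) (hm : 1 ≤ m) (p : ℝ) (hp : 1 < p)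
    (u : Euc n → EuclideanSpace ℝ (Fin m)) (hreg : ContDiff ℝ (⊤ : ℕ∞) u)
    (hsol : ∀ (i : Fin m) (x : Euc n),
      lap (fun z => lap (fun w => u w i) z) x = ‖u x‖ ^ (p - 1) * u x i)
    (hstab : Stable2 n m p u Set.univ) :
    ∃ C : ℝ, 0 < C ∧
      (∀ (R : ℝ) (x : Euc n), 0 < R →
        (∫ z in ball x R,
            (Real.sqrt (∑ i, (lap (fun w => u w i) z) ^ 2) ^ 2 + ‖u z‖ ^ (p + 1)))
          ≤ C * R ^ (-(4 : ℝ)) * (∫ z in ball x (2 * R) \ ball x R, ‖u z‖ ^ 2)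
            + C * R ^ (-(2 : ℝ)) *
              (∫ z in ball x (2 * R) \ ball x R,
                ‖u z‖ * Real.sqrt (∑ i, (lap (fun w => u w i) z) ^ 2))) ∧
      (∀ (R : ℝ) (x : Euc n), 1 ≤ R →
        (∫ z in ball x R,
            (Real.sqrt (∑ i, (lap (fun w => u w i) z) ^ 2) ^ 2 + ‖u z‖ ^ (p + 1)))
          ≤ C * R ^ ((n : ℝ) - 4 * (p + 1) / (p - 1))) := by
  have hp1 : 0 < p - 1 := by linarith
  obtain ⟨k, hk⟩ := exists_nat_ge (4 / (p - 1))
  have hk0 : k ≠ 0 := by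
    rintro rfl
    have : 0 < 4 / (p - 1) := by positivity
    simp only [Nat.cast_zero] at hk
    linarith
  obtain ⟨C₀, hC₀, hcut⟩ := exists_cutoff n hk0
  set K := 40 / (p - 1) + 45 with hK
  have hKpos : 0 < K := by positivity
  obtain ⟨M, hM, habsorb⟩ := exists_absorb_le hp (mul_pos hKpos hC₀) hk
  set θ := max (1 / 2) (2 / (p + 1)) with hθ
  have hθ1 : 0 < 1 - θ := by
    have : θ < 1 := max_lt (by norm_num) ((div_lt_one (by linarith)).2 (by linarith))
    linarith
  have hθ0 : 0 ≤ θ := le_max_of_le_left (by norm_num)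
  set V := volume.real (ball (0 : Euc n) 2) with hV
  have hV0 : 0 ≤ V := measureReal_nonneg
  set W : Euc n → ℝ := fun z => √(∑ i, lap (fun w => u w i) z ^ 2) with hW
  have hWc : Continuous W := continuous_sqrt_sum_lap_sq hreg
  have hW0 : ∀ z, 0 ≤ W z := fun z => Real.sqrt_nonneg _
  have huc : Continuous u := hreg.continuous
  set F : Euc n → ℝ := fun z => W z ^ 2 + ‖u z‖ ^ (p + 1) with hF
  have hFc : Continuous F :=
    (hWc.pow 2).add (huc.norm.rpow_const fun _ => Or.inr (by linarith))
  have hF0 : ∀ z, 0 ≤ F z := fun z =>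
    add_nonneg (sq_nonneg _) (Real.rpow_nonneg (norm_nonneg _) _)
  have hball : ∀ (g : Euc n → ℝ), Continuous g → ∀ x r, IntegrableOn g (ball x r) :=
    fun g hg x r => (hg.continuousOn.integrableOn_compact
      (isCompact_closedBall x r)).mono_set ball_subset_closedBall
  have hlow : ∀ (ψ : Euc n → ℝ) (x : Euc n) (R : ℝ), Continuous ψ → HasCompactSupport ψ →
      (∀ z ∈ ball x R, ψ z = 1) → ∫ z in ball x R, F z ≤ ∫ z, F z * ψ z ^ 2 := by
    intro ψ x R hψ hc hone
    rw [← integral_indicator measurableSet_ball]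
    refine integral_mono ((hball F hFc x R).integrable_indicator measurableSet_ball)
      (integrable_mul_sq hFc hψ hc) fun z => ?_
    by_cases hz : z ∈ ball x R
    · simp [Set.indicator_of_mem hz, hone z hz]
    · simpa [Set.indicator_of_notMem hz] using mul_nonneg (hF0 z) (sq_nonneg _)
  refine ⟨max (K * C₀) (M * V / (1 - θ)), lt_max_of_lt_left (by positivity), ?_, ?_⟩
  · intro R x hR
    obtain ⟨η, hη, hηc, hη0, hη1, hin, hout, hzero, hgrad, hlap⟩ := hcut R x hR
    set ψ : Euc n → ℝ := fun y => η y ^ (k + 2) with hψ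
    have hψs : ContDiff ℝ (⊤ : ℕ∞) ψ := hη.pow _
    have hψc : HasCompactSupport ψ := hηc.comp_left (g := fun t : ℝ => t ^ (k + 2)) (by simp)
    have hmain := hstab.integral_energy_mul_sq_le hp hreg hsol hψs hψc
    set A := ball x (2 * R) \ ball x R with hA
    have hAm : MeasurableSet A := measurableSet_ball.diff measurableSet_ball
    have i1 : IntegrableOn (fun z => ‖u z‖ ^ 2) A :=
      (hball _ (by fun_prop) x (2 * R)).mono_set Set.sdiff_subset
    have i2 : IntegrableOn (fun z => ‖u z‖ * W z) A :=
      (hball _ (by fun_prop) x (2 * R)).mono_set Set.sdiff_subset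
    have hupp : ∫ z, vectorCutoffError u ψ z
        ≤ C₀ * R⁻¹ ^ 4 * (∫ z in A, ‖u z‖ ^ 2) + C₀ * R⁻¹ ^ 2 * ∫ z in A, ‖u z‖ * W z := by
      rw [← integral_const_mul, ← integral_const_mul,
        ← integral_add (i1.const_mul _) (i2.const_mul _), ← integral_indicator hAm]
      refine integral_mono (integrable_vectorCutoffError hreg hψs hψc)
        (IntegrableOn.integrable_indicator ((i1.const_mul _).add (i2.const_mul _)) hAm) fun z => ?_
      refine Set.le_indicator (f := vectorCutoffError u ψ) (fun z hz => ?_) (fun z hz => ?_) z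
      · have hg : gradSq ψ z ≤ C₀ * R⁻¹ ^ 2 := (hgrad z).trans
          (mul_le_of_le_one_right (by positivity) (pow_le_one₀ (hη0 z) (hη1 z)))
        have hl : |lap (gradSq ψ) z| + lap ψ z ^ 2 ≤ C₀ * R⁻¹ ^ 4 := (hlap z).trans
          (mul_le_of_le_one_right (by positivity) (pow_le_one₀ (hη0 z) (hη1 z)))
        have h1 := mul_le_mul_of_nonneg_left hl (sq_nonneg ‖u z‖)
        have h2 := mul_le_mul_of_nonneg_left hg (mul_nonneg (norm_nonneg (u z)) (hW0 z))
        change ‖u z‖ ^ 2 * _ + ‖u z‖ * W z * _ ≤ _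
        linarith
      · by_cases hzR : z ∈ ball x R
        · obtain ⟨h1, h2⟩ := hzero z hzR
          simp only [vectorCutoffError]
          rw [h1, h2]
          simp
        · have hz0 := hout z fun h => hz ⟨h, hzR⟩
          have h1 := hgrad z
          have h2 := hlap z
          rw [hz0, zero_pow (by omega), mul_zero] at h1 h2
          change ‖u z‖ ^ 2 * _ + ‖u z‖ * W z * _ ≤ _
          exact add_nonpos (mul_nonpos_of_nonneg_of_nonpos (sq_nonneg _) h2)
            (mul_nonpos_of_nonneg_of_nonpos (mul_nonneg (norm_nonneg _) (hW0 z)) h1)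
    have e4 : R ^ (-(4 : ℝ)) = R⁻¹ ^ 4 := by
      rw [Real.rpow_neg hR.le, inv_pow]
      norm_cast
    have e2 : R ^ (-(2 : ℝ)) = R⁻¹ ^ 2 := by
      rw [Real.rpow_neg hR.le, inv_pow]
      norm_cast
    rw [e4, e2]
    have hI1 : 0 ≤ ∫ z in A, ‖u z‖ ^ 2 := integral_nonneg fun z => sq_nonneg _
    have hI2 : 0 ≤ ∫ z in A, ‖u z‖ * W z :=
      integral_nonneg fun z => mul_nonneg (norm_nonneg _) (hW0 z)
    calc ∫ z in ball x R, F z ≤ K * ∫ z, vectorCutoffError u ψ z :=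
          (hlow ψ x R hψs.continuous hψc fun z hz => by simp [hψ, hin z hz]).trans hmain
      _ ≤ K * (C₀ * R⁻¹ ^ 4 * (∫ z in A, ‖u z‖ ^ 2)
          + C₀ * R⁻¹ ^ 2 * ∫ z in A, ‖u z‖ * W z) := by gcongr
      _ = (K * C₀) * (R⁻¹ ^ 4 * (∫ z in A, ‖u z‖ ^ 2)
          + R⁻¹ ^ 2 * ∫ z in A, ‖u z‖ * W z) := by ring
      _ ≤ max (K * C₀) (M * V / (1 - θ)) * (R⁻¹ ^ 4 * (∫ z in A, ‖u z‖ ^ 2)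
          + R⁻¹ ^ 2 * ∫ z in A, ‖u z‖ * W z) :=
        mul_le_mul_of_nonneg_right (le_max_left _ _) (by positivity)
      _ = _ := by ring
  · intro R x hR1
    have hR : 0 < R := by linarith
    obtain ⟨η, hη, hηc, hη0, hη1, hin, hout, hzero, hgrad, hlap⟩ := hcut R x hR
    set ψ : Euc n → ℝ := fun y => η y ^ (k + 2) with hψ
    have hψs : ContDiff ℝ (⊤ : ℕ∞) ψ := hη.pow _
    have hψc : HasCompactSupport ψ := hηc.comp_left (g := fun t : ℝ => t ^ (k + 2)) (by simp)
    have hmain := hstab.integral_energy_mul_sq_le hp hreg hsol hψs hψc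
    have hFψ := integrable_mul_sq hFc hψs.continuous hψc
    have hVCE := integrable_vectorCutoffError hreg hψs hψc
    set Q := M * R⁻¹ ^ (4 * (p + 1) / (p - 1)) with hQ
    have hQ0 : 0 ≤ Q := by positivity
    set J := ∫ z, F z * ψ z ^ 2 with hJ
    have hconst : Integrable ((ball x (2 * R)).indicator fun _ => Q) :=
      (integrableOn_const measure_ball_lt_top.ne).integrable_indicator measurableSet_ball
    have hupp : K * ∫ z, vectorCutoffError u ψ z ≤ θ * J + Q * (R ^ n * V) := by
      have hQint : ∫ z, (ball x (2 * R)).indicator (fun _ => Q) z = Q * (R ^ n * V) := by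
        rw [integral_indicator measurableSet_ball, setIntegral_const,
          measureReal_ball_two_mul n x hR, smul_eq_mul, mul_comm]
      rw [← hQint, hJ, ← integral_const_mul, ← integral_const_mul,
        ← integral_add (hFψ.const_mul θ) hconst]
      refine integral_mono (hVCE.const_mul K) ((hFψ.const_mul θ).add hconst) fun z => ?_
      have hle : vectorCutoffError u ψ z ≤ ‖u z‖ ^ 2 * (C₀ * R⁻¹ ^ 4 * η z ^ (2 * k))
          + ‖u z‖ * W z * (C₀ * R⁻¹ ^ 2 * η z ^ (2 * k + 2)) :=
        add_le_add (mul_le_mul_of_nonneg_left (hlap z) (sq_nonneg _))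
          (mul_le_mul_of_nonneg_left (hgrad z) (mul_nonneg (norm_nonneg _) (hW0 z)))
      have hleK := mul_le_mul_of_nonneg_left hle hKpos.le
      by_cases hz : z ∈ ball x (2 * R)
      · have h := habsorb ‖u z‖ (W z) (η z) R⁻¹ (norm_nonneg _) (hW0 z) (hη0 z) (hη1 z)
          (inv_pos.2 hR)
        simp only [Set.indicator_of_mem hz]
        change _ ≤ θ * ((W z ^ 2 + ‖u z‖ ^ (p + 1)) * (η z ^ (k + 2)) ^ 2) + Q
        linarith
      · simp only [Set.indicator_of_notMem hz, add_zero]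
        rw [hout z hz, zero_pow (by omega), zero_pow (by omega)] at hleK
        have := mul_nonneg hθ0 (mul_nonneg (hF0 z) (sq_nonneg (ψ z)))
        linarith
    have hRe : R⁻¹ ^ (4 * (p + 1) / (p - 1)) * R ^ n = R ^ ((n : ℝ) - 4 * (p + 1) / (p - 1)) := by
      rw [Real.inv_rpow hR.le, Real.rpow_sub hR, Real.rpow_natCast]
      ring
    have hfin : J ≤ M * V / (1 - θ) * R ^ ((n : ℝ) - 4 * (p + 1) / (p - 1)) := by
      rw [← hRe, div_mul_eq_mul_div, le_div_iff₀ hθ1]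
      have e : Q * (R ^ n * V) = M * V * (R⁻¹ ^ (4 * (p + 1) / (p - 1)) * R ^ n) := by
        rw [hQ]
        ring
      have hmain' : J ≤ K * ∫ z, vectorCutoffError u ψ z := hmain
      linarith
    exact ((hlow ψ x R hψs.continuous hψc fun z hz => by simp [hψ, hin z hz]).trans hfin).trans
      (mul_le_mul_of_nonneg_right (le_max_right _ _) (Real.rpow_nonneg hR.le _))
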